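/- Let v be a smooth time-dependent vector field on a moving domain Ω_f(t) whose Piola-type ALE material derivative vanishes (i.e., its Lagrangian pullback v̂ = J F^{-1} (v∘Φ_t) is time-independent). Then d/dt ∫_{Ω_f(t)} |v|² dx = ∫_{Ω_f(t)} (2(∇w)v - (∇·w)v)·v dx, where w is the domain velocity. -/

import Mathlib

open Matrix MeasureTheory

/-- Divergence of a vector field, `div v = ∑ i ∂ᵢ vᵢ`. -/
noncomputable def vdiv {d : ℕ} (v : (Fin d → ℝ) → (Fin d → ℝ)) (x : Fin d → ℝ) : ℝ :=
  ∑ i, fderiv ℝ v x (Pi.single i 1) i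

theorem aux_det_deriv {d : ℕ} (M : ℝ → Matrix (Fin d) (Fin d) ℝ) (A : Matrix (Fin d) (Fin d) ℝ)
    (s : ℝ) (h : ∀ i j, HasDerivAt (fun r => M r i j) ((A * M s) i j) s) :
    HasDerivAt (fun r => (M r).det) (A.trace * (M s).det) s := by
  have h1 : HasDerivAt (fun r => (M r).det)
      (∑ i, ((M s).updateCol i (fun k => (A * M s) k i)).det) s := by
    have h2 : HasDerivAt (fun r => ∑ σ : Equiv.Perm (Fin d), ((Equiv.Perm.sign σ : ℤ) : ℝ) * ∏ i, M r (σ i) i)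
      (∑ σ : Equiv.Perm (Fin d), ((Equiv.Perm.sign σ : ℤ) : ℝ) *
        ∑ i, (∏ j ∈ Finset.univ.erase i, M s (σ j) j) • (A * M s) (σ i) i) s := by
      refine HasDerivAt.fun_sum fun σ _ => ?_
      refine HasDerivAt.const_mul _ ?_
      exact HasDerivAt.fun_finsetProd (u := Finset.univ)
        (f := fun i r => M r (σ i) i) (f' := fun i => (A * M s) (σ i) i) fun i _ => h (σ i) i
    simp only [Matrix.det_apply'] 
    convert h2 using 1
    simp only [Finset.mul_sum]
    rw [Finset.sum_comm]
    refine Finset.sum_congr rfl fun σ _ => Finset.sum_congr rfl fun i _ => ?_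
    congr 1
    rw [← Finset.mul_prod_erase Finset.univ _ (Finset.mem_univ i), smul_eq_mul, mul_comm]
    congr 1
    · refine Finset.prod_congr rfl fun j hj => ?_
      rw [Matrix.updateCol_ne (Finset.ne_of_mem_erase hj)]
    · simp
  convert h1 using 1
  have h3 : ∀ i, ((M s).updateCol i (fun k => (A * M s) k i)).det
      = ((M s).adjugate * (A * M s)) i i := by
    intro i
    rw [← Matrix.cramer_apply, Matrix.cramer_eq_adjugate_mulVec]
    rfl
  simp only [h3]
  change _ = Matrix.trace _
  rw [← Matrix.mul_assoc, Matrix.trace_mul_comm, ← Matrix.mul_assoc, Matrix.mul_adjugate]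
  simp [mul_comm]

theorem aux_slice {d : ℕ} (Φ : ℝ → (Fin d → ℝ) → (Fin d → ℝ))
    (hΦ : ContDiff ℝ (⊤ : ℕ∞) (fun p : ℝ × (Fin d → ℝ) => Φ p.1 p.2)) (s : ℝ) (x : Fin d → ℝ) :
    HasFDerivAt (Φ s) ((fderiv ℝ (fun p : ℝ × (Fin d → ℝ) => Φ p.1 p.2) (s, x)).comp
      (ContinuousLinearMap.inr ℝ ℝ (Fin d → ℝ))) x := by
  have h1 := (hΦ.differentiable (by simp) (s, x)).hasFDerivAt
  have h2 : HasFDerivAt (fun y : Fin d → ℝ => (s, y)) (ContinuousLinearMap.inr ℝ ℝ (Fin d → ℝ)) x :=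
    hasFDerivAt_prodMk_right s x
  exact h1.comp x h2

theorem aux_slice_apply {d : ℕ} (Φ : ℝ → (Fin d → ℝ) → (Fin d → ℝ))
    (hΦ : ContDiff ℝ (⊤ : ℕ∞) (fun p : ℝ × (Fin d → ℝ) => Φ p.1 p.2)) (s : ℝ) (x y : Fin d → ℝ) :
    fderiv ℝ (Φ s) x y = fderiv ℝ (fun p : ℝ × (Fin d → ℝ) => Φ p.1 p.2) (s, x) (0, y) := by
  rw [(aux_slice Φ hΦ s x).fderiv]; simp

theorem aux_mixed {d : ℕ} (Φ w : ℝ → (Fin d → ℝ) → (Fin d → ℝ))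
    (hΦ : ContDiff ℝ (⊤ : ℕ∞) (fun p : ℝ × (Fin d → ℝ) => Φ p.1 p.2))
    (hw : ContDiff ℝ (⊤ : ℕ∞) (fun p : ℝ × (Fin d → ℝ) => w p.1 p.2))
    (hvel : ∀ s xh, HasDerivAt (fun r => Φ r xh) (w s (Φ s xh)) s) (s : ℝ) (x y : Fin d → ℝ) :
    HasDerivAt (fun r => fderiv ℝ (Φ r) x y) (fderiv ℝ (w s) (Φ s x) (fderiv ℝ (Φ s) x y)) s := by
  set Ψ := fun p : ℝ × (Fin d → ℝ) => Φ p.1 p.2 with hΨ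
  have hd : Differentiable ℝ Ψ := hΦ.differentiable (by simp)
  have hD : Differentiable ℝ (fderiv ℝ Ψ) :=
    (hΦ.fderiv_right (m := 1) (by norm_cast)).differentiable (by simp)
  have hsym : IsSymmSndFDerivAt ℝ Ψ (s, x) :=
    hΦ.contDiffAt.isSymmSndFDerivAt (by simp only [minSmoothness_of_isRCLikeNormedField]; exact WithTop.coe_le_coe.2 (le_top : (2 : ℕ∞) ≤ ⊤))
  have ht : ∀ r z, fderiv ℝ Ψ (r, z) (1, 0) = w r (Φ r z) := by
    intro r z
    have h1 : HasDerivAt (fun q : ℝ => (q, z)) ((1 : ℝ), (0 : Fin d → ℝ)) r :=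
      (hasDerivAt_id r).prodMk (hasDerivAt_const r z)
    have h2 : HasDerivAt (fun q => Φ q z) (fderiv ℝ Ψ (r, z) (1, 0)) r :=
      HasFDerivAt.comp_hasDerivAt (l := Ψ) r (hd (r, z)).hasFDerivAt h1
    exact h2.unique (hvel r z)
  have hA : HasDerivAt (fun r => fderiv ℝ Ψ (r, x) (0, y))
      (fderiv ℝ (fderiv ℝ Ψ) (s, x) (1, 0) (0, y)) s := by
    have h1 : HasDerivAt (fun q : ℝ => (q, x)) ((1 : ℝ), (0 : Fin d → ℝ)) s :=
      (hasDerivAt_id s).prodMk (hasDerivAt_const s x)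
    have h2 := (hD (s, x)).hasFDerivAt.comp_hasDerivAt s h1
    have h3 := h2.clm_apply (hasDerivAt_const s ((0 : ℝ), y))
    simpa using h3
  have hB : HasFDerivAt (fun z => fderiv ℝ Ψ (s, z) (1, 0))
      (((fderiv ℝ (fderiv ℝ Ψ) (s, x)).comp
        (ContinuousLinearMap.inr ℝ ℝ (Fin d → ℝ))).flip (1, 0)) x := by
    have h2 := (hD (s, x)).hasFDerivAt.comp x (hasFDerivAt_prodMk_right s x)
    have h3 := h2.clm_apply (hasFDerivAt_const ((1 : ℝ), (0 : Fin d → ℝ)) x)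
    simpa using h3
  have hC : HasFDerivAt (fun z => w s (Φ s z))
      ((fderiv ℝ (w s) (Φ s x)).comp (fderiv ℝ (Φ s) x)) x :=
    (aux_slice w hw s (Φ s x)).differentiableAt.hasFDerivAt.comp x
      (aux_slice Φ hΦ s x).differentiableAt.hasFDerivAt
  simp only [ht] at hB
  have hE := congrArg (fun L => L y) (hB.unique hC)
  simp at hE
  simp only [aux_slice_apply Φ hΦ _ x]
  rw [← aux_slice_apply Φ hΦ, ← hE, ← hsym.eq]
  exact hA

theorem aux_main {d : ℕ} (Φ v w : ℝ → (Fin d → ℝ) → (Fin d → ℝ))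
    (hΦ : ContDiff ℝ (⊤ : ℕ∞) (fun p : ℝ × (Fin d → ℝ) => Φ p.1 p.2))
    (hv : ContDiff ℝ (⊤ : ℕ∞) (fun p : ℝ × (Fin d → ℝ) => v p.1 p.2))
    (hw : ContDiff ℝ (⊤ : ℕ∞) (fun p : ℝ × (Fin d → ℝ) => w p.1 p.2))
    (hJ : ∀ s xh,
      0 < LinearMap.det (fderiv ℝ (Φ s) xh : (Fin d → ℝ) →ₗ[ℝ] (Fin d → ℝ)))
    (hvel : ∀ s xh, HasDerivAt (fun r => Φ r xh) (w s (Φ s xh)) s)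
    (hmat : ∀ s t xh,
      (LinearMap.det (fderiv ℝ (Φ s) xh : (Fin d → ℝ) →ₗ[ℝ] (Fin d → ℝ))) •
          (LinearMap.toMatrix'
            (fderiv ℝ (Φ s) xh : (Fin d → ℝ) →ₗ[ℝ] (Fin d → ℝ)))⁻¹.mulVec
              (v s (Φ s xh)) =
        (LinearMap.det (fderiv ℝ (Φ t) xh : (Fin d → ℝ) →ₗ[ℝ] (Fin d → ℝ))) •
          (LinearMap.toMatrix'
            (fderiv ℝ (Φ t) xh : (Fin d → ℝ) →ₗ[ℝ] (Fin d → ℝ)))⁻¹.mulVec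
              (v t (Φ t xh)))
    (s : ℝ) (x : Fin d → ℝ) :
    HasDerivAt (fun r => LinearMap.det (fderiv ℝ (Φ r) x : (Fin d → ℝ) →ₗ[ℝ] (Fin d → ℝ)) *
        ∑ i, v r (Φ r x) i * v r (Φ r x) i)
      (LinearMap.det (fderiv ℝ (Φ s) x : (Fin d → ℝ) →ₗ[ℝ] (Fin d → ℝ)) *
        ∑ i, ((2 : ℝ) • fderiv ℝ (w s) (Φ s x) (v s (Φ s x)) -
          vdiv (w s) (Φ s x) • v s (Φ s x)) i * v s (Φ s x) i) s := by
  set J : ℝ → ℝ := fun r => LinearMap.det (fderiv ℝ (Φ r) x : (Fin d → ℝ) →ₗ[ℝ] (Fin d → ℝ)) with hJdef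
  set u : ℝ → Fin d → ℝ := fun r => v r (Φ r x) with hu
  set A := fderiv ℝ (w s) (Φ s x) with hA
  have hmix := aux_mixed Φ w hΦ hw hvel s x
  -- derivative of J
  have hJ' : HasDerivAt J (vdiv (w s) (Φ s x) * J s) s := by
    have := aux_det_deriv
      (fun r => LinearMap.toMatrix' (fderiv ℝ (Φ r) x : (Fin d → ℝ) →ₗ[ℝ] (Fin d → ℝ)))
      (LinearMap.toMatrix' (A : (Fin d → ℝ) →ₗ[ℝ] (Fin d → ℝ))) s (by
        intro i j
        rw [← LinearMap.toMatrix'_mul]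
        have := (hasDerivAt_pi.1 (hmix (Pi.single j 1))) i
        simpa [LinearMap.toMatrix'_apply, ← Pi.single_apply] using this)
    simp only [LinearMap.det_toMatrix'] at this
    convert this using 2
    simp [vdiv, Matrix.trace, LinearMap.toMatrix'_apply, hA]
  -- derivative of u
  have hud : DifferentiableAt ℝ u s := by
    have h1 : DifferentiableAt ℝ (fun r : ℝ => (r, Φ r x)) s :=
      differentiableAt_id.prodMk (hvel s x).differentiableAt
    exact (hv.differentiable (by simp) (s, Φ s x)).comp s h1
  obtain ⟨u', hu'⟩ : ∃ u', HasDerivAt u u' s := ⟨_, hud.hasDerivAt⟩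
  set vh : Fin d → ℝ := J s • (LinearMap.toMatrix'
            (fderiv ℝ (Φ s) x : (Fin d → ℝ) →ₗ[ℝ] (Fin d → ℝ)))⁻¹.mulVec (u s) with hvh
  have hF : ∀ r, J r • u r = fderiv ℝ (Φ r) x vh := by
    intro r
    have hdet : IsUnit (LinearMap.toMatrix'
            (fderiv ℝ (Φ r) x : (Fin d → ℝ) →ₗ[ℝ] (Fin d → ℝ))).det := by
      rw [LinearMap.det_toMatrix']; exact (hJ r x).ne'.isUnit
    have h1 : vh = J r • (LinearMap.toMatrix'
            (fderiv ℝ (Φ r) x : (Fin d → ℝ) →ₗ[ℝ] (Fin d → ℝ)))⁻¹.mulVec (u r) := hmat s r x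
    have h2 : (fderiv ℝ (Φ r) x) vh = (LinearMap.toMatrix'
            (fderiv ℝ (Φ r) x : (Fin d → ℝ) →ₗ[ℝ] (Fin d → ℝ))) *ᵥ vh := by
      rw [LinearMap.toMatrix'_mulVec]; rfl
    rw [h2, h1, Matrix.mulVec_smul, Matrix.mulVec_mulVec, Matrix.mul_nonsing_inv _ hdet,
      Matrix.one_mulVec]
  have hprod : J s • u' + (vdiv (w s) (Φ s x) * J s) • u s = J s • A (u s) := by
    have h1 := hJ'.smul hu'
    have h2 := hmix vh
    have h3 : (J • u) = fun r => fderiv ℝ (Φ r) x vh := funext hF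
    rw [h3] at h1
    rw [h1.unique h2, ← hF, map_smul]
  have hfin : HasDerivAt (fun r => J r * ∑ i, u r i * u r i)
      ((vdiv (w s) (Φ s x) * J s) * (∑ i, u s i * u s i) +
        J s * ∑ i, (u' i * u s i + u s i * u' i)) s := by
    refine hJ'.mul (HasDerivAt.fun_sum fun i _ => ?_)
    have := hasDerivAt_pi.1 hu' i
    exact this.mul this
  convert hfin using 1
  rw [Finset.mul_sum, Finset.mul_sum, Finset.mul_sum, ← Finset.sum_add_distrib]
  refine Finset.sum_congr rfl fun i _ => ?_
  have := congrFun hprod i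
  simp only [Pi.add_apply, Pi.smul_apply, smul_eq_mul, Pi.sub_apply] at this ⊢
  linear_combination (-2 * u s i) * this

/-- Identity (2.19): if the Piola-type ALE material derivative of `v` vanishes
(i.e. its Lagrangian pullback `J F⁻¹ (v∘Φₜ)` is time-independent), then
`d/dt ∫ |v|² = ∫ (2(∇w)v - (∇·w)v)·v`. -/
theorem stmt_13 (d : ℕ) (Omh : Set (Fin d → ℝ))
    (hOmh : MeasurableSet Omh) (hcomp : IsCompact Omh)
    (Φ : ℝ → (Fin d → ℝ) → (Fin d → ℝ))
    (v w : ℝ → (Fin d → ℝ) → (Fin d → ℝ))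
    (hΦ : ContDiff ℝ (⊤ : ℕ∞) (fun p : ℝ × (Fin d → ℝ) => Φ p.1 p.2))
    (hv : ContDiff ℝ (⊤ : ℕ∞) (fun p : ℝ × (Fin d → ℝ) => v p.1 p.2))
    (hw : ContDiff ℝ (⊤ : ℕ∞) (fun p : ℝ × (Fin d → ℝ) => w p.1 p.2))
    (hinj : ∀ s, Function.Injective (Φ s))
    (hJ : ∀ s xh,
      0 < LinearMap.det (fderiv ℝ (Φ s) xh : (Fin d → ℝ) →ₗ[ℝ] (Fin d → ℝ)))
    (hvel : ∀ s xh, HasDerivAt (fun r => Φ r xh) (w s (Φ s xh)) s)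
    -- vanishing Piola-type material derivative: the Lagrangian pullback
    -- `v̂ = J F⁻¹ (v ∘ Φₜ)` is independent of time
    (hmat : ∀ s t xh,
      (LinearMap.det (fderiv ℝ (Φ s) xh : (Fin d → ℝ) →ₗ[ℝ] (Fin d → ℝ))) •
          (LinearMap.toMatrix'
            (fderiv ℝ (Φ s) xh : (Fin d → ℝ) →ₗ[ℝ] (Fin d → ℝ)))⁻¹.mulVec
              (v s (Φ s xh)) =
        (LinearMap.det (fderiv ℝ (Φ t) xh : (Fin d → ℝ) →ₗ[ℝ] (Fin d → ℝ))) •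
          (LinearMap.toMatrix'
            (fderiv ℝ (Φ t) xh : (Fin d → ℝ) →ₗ[ℝ] (Fin d → ℝ)))⁻¹.mulVec
              (v t (Φ t xh)))
    (t : ℝ) :
    HasDerivAt (fun s => ∫ x in Φ s '' Omh, ∑ i, v s x i * v s x i)
      (∫ x in Φ t '' Omh,
        ∑ i, ((2 : ℝ) • fderiv ℝ (w t) x (v t x) - vdiv (w t) x • v t x) i * v t x i)
      t := by
  set G : ℝ → (Fin d → ℝ) → ℝ := fun s x =>
    LinearMap.det (fderiv ℝ (Φ s) x : (Fin d → ℝ) →ₗ[ℝ] (Fin d → ℝ)) *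
        ∑ i, v s (Φ s x) i * v s (Φ s x) i with hG
  set G' : ℝ → (Fin d → ℝ) → ℝ := fun s x =>
    LinearMap.det (fderiv ℝ (Φ s) x : (Fin d → ℝ) →ₗ[ℝ] (Fin d → ℝ)) *
        ∑ i, ((2 : ℝ) • fderiv ℝ (w s) (Φ s x) (v s (Φ s x)) -
          vdiv (w s) (Φ s x) • v s (Φ s x)) i * v s (Φ s x) i with hG'
  have hcv : ∀ (s : ℝ) (g : (Fin d → ℝ) → ℝ), ∫ x in Φ s '' Omh, g x =
      ∫ x in Omh, LinearMap.det (fderiv ℝ (Φ s) x : (Fin d → ℝ) →ₗ[ℝ] (Fin d → ℝ)) * g (Φ s x) := by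
    intro s g
    rw [integral_image_eq_integral_abs_det_fderiv_smul volume hOmh
      (fun x _ => (aux_slice Φ hΦ s x).differentiableAt.hasFDerivAt.hasFDerivWithinAt)
      (hinj s).injOn g]
    refine setIntegral_congr_fun hOmh fun x _ => ?_
    have : (fderiv ℝ (Φ s) x).det =
      LinearMap.det (fderiv ℝ (Φ s) x : (Fin d → ℝ) →ₗ[ℝ] (Fin d → ℝ)) := rfl
    simp only [this, abs_of_pos (hJ s x), smul_eq_mul]
  simp only [hcv]
  have hDΦ : Continuous (fderiv ℝ (fun p : ℝ × (Fin d → ℝ) => Φ p.1 p.2)) :=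
    hΦ.continuous_fderiv (by simp)
  have hDw : Continuous (fderiv ℝ (fun p : ℝ × (Fin d → ℝ) => w p.1 p.2)) :=
    hw.continuous_fderiv (by simp)
  have hcΦ : Continuous (fun p : ℝ × (Fin d → ℝ) => Φ p.1 p.2) := hΦ.continuous
  have hcv' : Continuous (fun p : ℝ × (Fin d → ℝ) => v p.1 (Φ p.1 p.2)) :=
    hv.continuous.comp (continuous_fst.prodMk hcΦ)
  have hcJ : Continuous (fun p : ℝ × (Fin d → ℝ) =>
      LinearMap.det (fderiv ℝ (Φ p.1) p.2 : (Fin d → ℝ) →ₗ[ℝ] (Fin d → ℝ))) := by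
    change Continuous (fun p : ℝ × (Fin d → ℝ) => (fderiv ℝ (Φ p.1) p.2).det)
    refine ContinuousLinearMap.continuous_det.comp ?_
    have : (fun p : ℝ × (Fin d → ℝ) => fderiv ℝ (Φ p.1) p.2) = fun p =>
      (fderiv ℝ (fun p : ℝ × (Fin d → ℝ) => Φ p.1 p.2) p).comp
        (ContinuousLinearMap.inr ℝ ℝ (Fin d → ℝ)) := by
      funext p
      exact (aux_slice Φ hΦ p.1 p.2).fderiv
    rw [this]
    exact hDΦ.clm_comp continuous_const
  have hcDw : ∀ f : ℝ × (Fin d → ℝ) → (Fin d → ℝ), Continuous f →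
      Continuous (fun p : ℝ × (Fin d → ℝ) => fderiv ℝ (w p.1) (Φ p.1 p.2) (f p)) := by
    intro f hf
    simp only [aux_slice_apply w hw]
    exact (hDw.comp (continuous_fst.prodMk hcΦ)).clm_apply (continuous_const.prodMk hf)
  have hcG : Continuous (fun p : ℝ × (Fin d → ℝ) => G p.1 p.2) := by
    refine hcJ.mul (continuous_finsetSum _ fun i _ => ?_)
    have := (continuous_apply i).comp hcv'
    exact this.mul this
  have hcG' : Continuous (fun p : ℝ × (Fin d → ℝ) => G' p.1 p.2) := by
    refine hcJ.mul (continuous_finsetSum _ fun i _ => ?_)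
    refine Continuous.mul ?_ ((continuous_apply i).comp hcv')
    have hdiv : Continuous (fun p : ℝ × (Fin d → ℝ) => vdiv (w p.1) (Φ p.1 p.2)) :=
      continuous_finsetSum _ fun j _ => (continuous_apply j).comp (hcDw _ continuous_const)
    have h2 := hcDw _ hcv'
    have h3 : Continuous (fun p : ℝ × (Fin d → ℝ) =>
        (2 : ℝ) • fderiv ℝ (w p.1) (Φ p.1 p.2) (v p.1 (Φ p.1 p.2)) -
          vdiv (w p.1) (Φ p.1 p.2) • v p.1 (Φ p.1 p.2)) := by
      fun_prop
    exact (continuous_apply i).comp h3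
  obtain ⟨C, hC⟩ := ((isCompact_Icc (a := t - 1) (b := t + 1)).prod hcomp).exists_bound_of_continuousOn
    hcG'.continuousOn
  have hslice : ∀ s, Continuous (G s) := fun s => hcG.comp (continuous_const.prodMk continuous_id)
  have hslice' : ∀ s, Continuous (G' s) := fun s => hcG'.comp (continuous_const.prodMk continuous_id)
  refine (hasDerivAt_integral_of_dominated_loc_of_deriv_le (μ := volume.restrict Omh)
    (F := G) (F' := G') (bound := fun _ => C) (s := Set.Icc (t - 1) (t + 1)) (x₀ := t)
    (Icc_mem_nhds (by linarith) (by linarith)) ?_ ?_ ?_ ?_ ?_ ?_).2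
  · exact Filter.Eventually.of_forall fun s => (hslice s).aestronglyMeasurable
  · exact (hslice t).continuousOn.integrableOn_compact hcomp
  · exact (hslice' t).aestronglyMeasurable
  · exact (ae_restrict_mem hOmh).mono fun x hx s hs => hC (s, x) ⟨hs, hx⟩
  · exact continuousOn_const.integrableOn_compact hcomp
  · exact Filter.Eventually.of_forall fun x s _ =>
      aux_main Φ v w hΦ hv hw hJ hvel hmat s x
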